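/- arXiv:0904.0942 — 2 statements merged into one kernel-verified Lean document; each statement's English description precedes it below -/
import Mathlib

section
/- Let s ∈ ℝ^n be a nondecreasing vector with d distinct values, where the r-th distinct value occurs n_r times (so Σ_r n_r = n). Let ε > 0, let s̃ = s + η where η has i.i.d. coordinates distributed as Laplace with scale 1/ε (density x ↦ (ε/2)·exp(−ε|x|)), and let s̄ be the isotonic regression of s̃, i.e., the unique nondecreasing minimizer of ‖s̃ − t‖₂, given coordinatewise by s̄[k] = max_{i ∈ [1,k]} min_{j ∈ [i,n]} M̃[i,j] where M̃[i,j] is the mean of s̃ over indices [i,j]. Then there exist universal constants c₁ and c₂, independent of n and d, such that E‖s̄ − s‖₂² ≤ Σ_{r=1}^{d} (c₁·log³(n_r) + c₂)/ε². In particular E‖s̄ − s‖₂² = O(d·log³(n)/ε²), whereas E‖s̃ − s‖₂² = 2n/ε². -/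
open MeasureTheory

/-- The Laplace measure on `ℝ` with scale `b`: density `x ↦ (1/(2b))·exp(−|x|/b)`. -/
noncomputable def laplaceMeasure (b : ℝ) : Measure ℝ :=
  volume.withDensity fun x => ENNReal.ofReal ((2 * b)⁻¹ * Real.exp (-|x| / b))

/-- `seqMean t i j` is the mean `M̃[i,j]` of the entries of `t` with indices in `[i,j]`. -/
noncomputable def seqMean {n : ℕ} (t : Fin n → ℝ) (i j : Fin n) : ℝ :=
  (∑ k ∈ Finset.Icc i j, t k) / (((j : ℕ) - (i : ℕ) + 1 : ℕ) : ℝ)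

/-- The isotonic regression (minimum `L₂` nondecreasing solution) of `t`, given
coordinatewise by the min-max formula `s̄[k] = max_{i ∈ [1,k]} min_{j ∈ [i,n]} M̃[i,j]`. -/
noncomputable def iso {n : ℕ} (t : Fin n → ℝ) (k : Fin n) : ℝ :=
  (Finset.univ.filter fun i => i ≤ k).sup' ⟨k, by simp⟩ fun i =>
    (Finset.univ.filter fun j => i ≤ j).inf' ⟨i, by simp⟩ fun j => seqMean t i j

/-! ### Deterministic bounds for the min-max formula -/

/-- The mean of the entries of `x` indexed by `A`. -/
noncomputable def avg {ι : Type*} (A : Finset ι) (x : ι → ℝ) : ℝ :=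
  (∑ i ∈ A, x i) / (A.card : ℝ)

lemma seqMean_eq_avg {n : ℕ} (t : Fin n → ℝ) {i j : Fin n} (h : i ≤ j) :
    seqMean t i j = avg (Finset.Icc i j) t := by
  have h' : (i : ℕ) ≤ j := h
  unfold seqMean avg
  congr 2
  rw [Fin.card_Icc]
  omega

lemma exists_iso_le_seqMean {n : ℕ} (t : Fin n → ℝ) {k b : Fin n} (hb : k ≤ b) :
    ∃ i ≤ k, iso t k ≤ seqMean t i b := by
  obtain ⟨i, hi, h⟩ := Finset.exists_mem_eq_sup' (s := Finset.univ.filter fun i => i ≤ k)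
    ⟨k, by simp⟩ (fun i =>
      (Finset.univ.filter fun j => i ≤ j).inf' ⟨i, by simp⟩ fun j => seqMean t i j)
  have hik : i ≤ k := by simpa using hi
  refine ⟨i, hik, ?_⟩
  unfold iso
  rw [h]
  exact Finset.inf'_le _ (by simpa using hik.trans hb)

lemma seqMean_mul_card {n : ℕ} (t : Fin n → ℝ) (i j : Fin n) :
    seqMean t i j * (((j : ℕ) - (i : ℕ) + 1 : ℕ) : ℝ) = ∑ k ∈ Finset.Icc i j, t k := by
  unfold seqMean
  have : (((j : ℕ) - (i : ℕ) + 1 : ℕ) : ℝ) ≠ 0 := by positivity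
  field_simp

/-- In the min-max formula for the isotonic regression, the minimum may be restricted to the
intervals that contain `k`. -/
lemma exists_seqMean_le_iso {n : ℕ} (t : Fin n → ℝ) {a k : Fin n} (ha : a ≤ k) :
    ∃ j, k ≤ j ∧ seqMean t a j ≤ iso t k := by
  have hne : (Finset.univ.filter fun j => k ≤ j).Nonempty := ⟨k, by simp⟩
  set G : Fin n → ℝ := fun i => (Finset.univ.filter fun j => k ≤ j).inf' hne
    fun j => seqMean t i j with hG
  obtain ⟨i, hi, hmax⟩ := Finset.exists_max_image (Finset.univ.filter fun i => i ≤ k) G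
    ⟨k, by simp⟩
  simp only [Finset.mem_filter, Finset.mem_univ, true_and] at hi hmax
  have hGle (l j : Fin n) (hj : k ≤ j) : G l ≤ seqMean t l j :=
    Finset.inf'_le _ (by simpa using hj)
  have key : G i ≤ iso t k := by
    unfold iso
    refine le_trans ?_ (Finset.le_sup' _ (b := i) (by simpa using hi))
    refine Finset.le_inf' _ _ fun j hj => ?_
    simp only [Finset.mem_filter, Finset.mem_univ, true_and] at hj
    rcases le_or_gt k j with hkj | hjk
    · exact hGle i j hkj
    by_contra! hlt
    have hjk' : (j : ℕ) < k := hjk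
    have hkn := k.isLt
    let l : Fin n := ⟨j + 1, by omega⟩
    have hlk : l ≤ k := Fin.le_def.2 (by simp only [l]; omega)
    obtain ⟨j', hj', hl⟩ := Finset.exists_mem_eq_inf' hne fun j => seqMean t l j
    simp only [Finset.mem_filter, Finset.mem_univ, true_and] at hj'
    have hlG : seqMean t l j' ≤ G i := by rw [← hl]; exact hmax l hlk
    have hiG := hGle i j' hj'
    have hjj' : (j : ℕ) < j' := lt_of_lt_of_le hjk' hj'
    have hij : (i : ℕ) ≤ j := hj
    have hsum : ∑ m ∈ Finset.Icc i j', t m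
        = ∑ m ∈ Finset.Icc i j, t m + ∑ m ∈ Finset.Icc l j', t m := by
      rw [← Finset.sum_union]
      · congr 1
        ext m
        simp only [Finset.mem_Icc, Finset.mem_union, Fin.le_def, l]
        omega
      · rw [Finset.disjoint_left]
        intro m
        simp only [Finset.mem_Icc, Fin.le_def, l]
        omega
    rw [← seqMean_mul_card, ← seqMean_mul_card, ← seqMean_mul_card] at hsum
    have e : (((j' : ℕ) - (i : ℕ) + 1 : ℕ) : ℝ)
        = (((j : ℕ) - (i : ℕ) + 1 : ℕ) : ℝ) + (((j' : ℕ) - (l : ℕ) + 1 : ℕ) : ℝ) := by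
      rw [← Nat.cast_add]
      congr 1
      simp only [l]
      omega
    have p1 : (0 : ℝ) < (((j : ℕ) - (i : ℕ) + 1 : ℕ) : ℝ) := by positivity
    have p2 : (0 : ℝ) < (((j' : ℕ) - (l : ℕ) + 1 : ℕ) : ℝ) := by positivity
    have p3 : (0 : ℝ) < (((j' : ℕ) - (i : ℕ) + 1 : ℕ) : ℝ) := by positivity
    have q1 := mul_lt_mul_of_pos_right hlt p1
    have q2 := mul_le_mul_of_nonneg_right hlG p2.le
    have q3 := mul_le_mul_of_nonneg_right hiG p3.le
    rw [e] at q3 hsum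
    linarith
  obtain ⟨j, hj, hja⟩ := Finset.exists_mem_eq_inf' hne fun j => seqMean t a j
  refine ⟨j, by simpa using hj, ?_⟩
  rw [← hja]
  exact (hmax a ha).trans key

/-! ### A maximal inequality for means over shrinking index sets -/

/-- The running maximum of the positive parts of `z`. -/
noncomputable def runMax (z : ℕ → ℝ) : ℕ → ℝ :=
  partialSups fun t => max (z t) 0

lemma runMax_zero (z : ℕ → ℝ) : runMax z 0 = max (z 0) 0 := by simp [runMax]

lemma runMax_succ (z : ℕ → ℝ) (t : ℕ) :
    runMax z (t + 1) = max (runMax z t) (max (z (t + 1)) 0) := by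
  simp [runMax, partialSups_add_one]

lemma le_runMax (z : ℕ → ℝ) {t T : ℕ} (h : t ≤ T) : z t ≤ runMax z T :=
  (le_max_left _ _).trans (le_partialSups_of_le (fun t => max (z t) 0) h)

lemma runMax_nonneg (z : ℕ → ℝ) (t : ℕ) : 0 ≤ runMax z t :=
  (le_max_right _ _).trans (le_partialSups_of_le (fun t => max (z t) 0) (le_refl t))

lemma runMax_congr {z w : ℕ → ℝ} {T : ℕ} (h : ∀ t ≤ T, z t = w t) :
    runMax z T = runMax w T := by
  induction T with
  | zero => simp [runMax_zero, h]
  | succ T ih =>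
    rw [runMax_succ, runMax_succ, ih fun t ht => h t (by omega), h (T + 1) le_rfl]

lemma sq_runMax_le_aux (z : ℕ → ℝ) (T : ℕ) :
    runMax z T ^ 2 ≤ 2 * (runMax z T * z T)
      - 2 * ∑ t ∈ Finset.range T, runMax z t * (z (t + 1) - z t) := by
  induction T with
  | zero =>
    rw [runMax_zero]
    rcases le_total (z 0) 0 with h | h
    · simp [h]
    · simp only [max_eq_left h, Finset.range_zero, Finset.sum_empty]
      nlinarith
  | succ T ih =>
    rw [Finset.sum_range_succ, runMax_succ]
    have h0 := runMax_nonneg z T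
    rcases le_total (z (T + 1)) (runMax z T) with h | h
    · rw [max_eq_left (max_le h h0)]
      nlinarith
    · rw [max_eq_left (h0.trans h), max_eq_right h]
      nlinarith

/-- A pathwise form of Doob's `L²` inequality. -/
lemma sq_runMax_le (z : ℕ → ℝ) (T : ℕ) :
    runMax z T ^ 2 ≤ 4 * z T ^ 2
      - 4 * ∑ t ∈ Finset.range T, runMax z t * (z (t + 1) - z t) := by
  have := sq_runMax_le_aux z T
  nlinarith [sq_nonneg (runMax z T - 2 * z T)]

lemma avg_sub_avg {ι : Type*} {A B : Finset ι} (hA : A.Nonempty) (hB : B.Nonempty) (x : ι → ℝ) :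
    avg A x - avg B x = ((A.card : ℝ) * B.card)⁻¹ * ∑ i ∈ A, ∑ j ∈ B, (x i - x j) := by
  have h1 : (A.card : ℝ) ≠ 0 := by simpa using hA.ne_empty
  have h2 : (B.card : ℝ) ≠ 0 := by simpa using hB.ne_empty
  simp only [avg, Finset.sum_sub_distrib, Finset.sum_const, nsmul_eq_mul, ← Finset.mul_sum]
  field_simp

lemma avg_comp_swap {ι : Type*} [DecidableEq ι] {A : Finset ι} {i j : ι} (hi : i ∈ A) (hj : j ∈ A)
    (x : ι → ℝ) : avg A (fun k => x (Equiv.swap i j k)) = avg A x := by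
  unfold avg
  congr 1
  refine Finset.sum_equiv (Equiv.swap i j) (fun k => ?_) fun k _ => rfl
  rcases eq_or_ne k i with rfl | h1
  · simp [hi, hj]
  rcases eq_or_ne k j with rfl | h2
  · simp [hi, hj]
  rw [Equiv.swap_apply_of_ne_of_ne h1 h2]

section maximal

variable {ι : Type*} [Fintype ι] {μ : Measure ℝ} [IsProbabilityMeasure μ]

/-- If `f` is invariant under the exchange of `i` and `j`, then it is orthogonal to `xᵢ - xⱼ`. -/
lemma integral_mul_sub_eq_zero [DecidableEq ι] (f : (ι → ℝ) → ℝ) (i j : ι)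
    (hf : ∀ x : ι → ℝ, f (fun k => x (Equiv.swap i j k)) = f x) :
    ∫ x, f x * (x i - x j) ∂(Measure.pi fun _ : ι => μ) = 0 := by
  have hσ := (measurePreserving_piCongrLeft (fun _ : ι => μ) (Equiv.swap i j)).symm
  have h := hσ.integral_comp' (fun x : ι → ℝ => f x * (x i - x j))
  have h2 : ∀ x : ι → ℝ, (MeasurableEquiv.piCongrLeft (fun _ : ι => ℝ) (Equiv.swap i j)).symm x
      = fun k => x (Equiv.swap i j k) := fun x => rfl
  simp only [h2, hf, Equiv.swap_apply_left, Equiv.swap_apply_right] at h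
  have h3 : ∀ x : ι → ℝ, f x * (x j - x i) = -(f x * (x i - x j)) := fun x => by ring
  simp only [h3, integral_neg] at h
  linarith

lemma memLp_coord (hL2 : MemLp id 2 μ) (i : ι) :
    MemLp (fun x : ι → ℝ => x i) 2 (Measure.pi fun _ => μ) :=
  hL2.comp_measurePreserving (measurePreserving_eval _ i)

lemma memLp_avg (hL2 : MemLp id 2 μ) (A : Finset ι) :
    MemLp (fun x : ι → ℝ => avg A x) 2 (Measure.pi fun _ => μ) := by
  have h : MemLp (fun x : ι → ℝ => ∑ i ∈ A, x i) 2 (Measure.pi fun _ => μ) :=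
    memLp_finsetSum A fun i _ => memLp_coord hL2 i
  simpa only [avg, div_eq_inv_mul] using h.const_mul ((A.card : ℝ)⁻¹)

lemma memLp_runMax_avg (hL2 : MemLp id 2 μ) (c : ℝ) (A : ℕ → Finset ι) (T : ℕ) :
    MemLp (fun x : ι → ℝ => runMax (fun t => c * avg (A t) x) T) 2
      (Measure.pi fun _ => μ) := by
  induction T with
  | zero =>
    simp only [runMax_zero]
    exact ((memLp_avg hL2 (A 0)).const_mul c).pos_part
  | succ T ih =>
    simp only [runMax_succ]
    exact ih.sup ((memLp_avg hL2 (A (T + 1))).const_mul c).pos_part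

lemma integral_runMax_mul_eq_zero (hL2 : MemLp id 2 μ) (c : ℝ) {A : ℕ → Finset ι}
    (hA : Antitone A) {t : ℕ} (ht : (A (t + 1)).Nonempty) :
    ∫ x, runMax (fun t => c * avg (A t) x) t * (c * avg (A (t + 1)) x - c * avg (A t) x)
      ∂(Measure.pi fun _ : ι => μ) = 0 := by
  classical
  have hsub : A (t + 1) ⊆ A t := hA (Nat.le_succ t)
  have hexp (x : ι → ℝ) :
      runMax (fun t => c * avg (A t) x) t * (c * avg (A (t + 1)) x - c * avg (A t) x)
        = ∑ i ∈ A (t + 1), ∑ j ∈ A t, (c * (((A (t + 1)).card : ℝ) * (A t).card)⁻¹) *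
            (runMax (fun t => c * avg (A t) x) t * (x i - x j)) := by
    rw [← mul_sub, avg_sub_avg ht (ht.mono hsub)]
    simp only [← Finset.mul_sum]
    ring
  have hint (i j : ι) : Integrable
      (fun x : ι → ℝ => runMax (fun t => c * avg (A t) x) t * (x i - x j))
      (Measure.pi fun _ => μ) :=
    (memLp_runMax_avg hL2 c A t).integrable_mul
      ((memLp_coord hL2 i).sub (memLp_coord hL2 j))
  simp only [hexp]
  rw [integral_finsetSum _ fun i _ => integrable_finsetSum _ fun j _ => (hint i j).const_mul _]
  refine Finset.sum_eq_zero fun i hi => ?_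
  rw [integral_finsetSum _ fun j _ => (hint i j).const_mul _]
  refine Finset.sum_eq_zero fun j hj => ?_
  rw [integral_const_mul, integral_mul_sub_eq_zero, mul_zero]
  intro x
  refine runMax_congr fun l hl => ?_
  rw [avg_comp_swap (hA hl (hsub hi)) (hA hl hj)]

lemma integral_sq_avg (hL2 : MemLp id 2 μ) (h0 : ∫ y, y ∂μ = 0) (A : Finset ι) :
    ∫ x, avg A x ^ 2 ∂(Measure.pi fun _ : ι => μ) = (∫ y, y ^ 2 ∂μ) / A.card := by
  classical
  have hvar : ProbabilityTheory.variance id μ = ∫ y, y ^ 2 ∂μ := by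
    rw [ProbabilityTheory.variance_of_integral_eq_zero hL2.aemeasurable (by simpa using h0)]
    rfl
  let X : ι → ℝ → ℝ := fun i y => if i ∈ A then y else 0
  have hX (i : ι) : MemLp (X i) 2 μ := by
    by_cases hi : i ∈ A
    · simp only [X, hi, if_true]
      exact hL2
    · simp [X, hi]
  have hmean (i : ι) : ∫ x : ι → ℝ, x i ∂(Measure.pi fun _ => μ) = 0 :=
    (integral_comp_eval (μ := fun _ : ι => μ) (f := fun y : ℝ => y)
      aestronglyMeasurable_id).trans h0
  have hsum : (∑ i, fun x : ι → ℝ => X i (x i)) = fun x => ∑ i ∈ A, x i := by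
    ext x
    simp [X, Finset.sum_ite_mem]
  have hL : MemLp (fun x : ι → ℝ => ∑ i ∈ A, x i) 2 (Measure.pi fun _ => μ) :=
    memLp_finsetSum A fun i _ => memLp_coord hL2 i
  have hI (i : ι) : Integrable (fun x : ι → ℝ => x i) (Measure.pi fun _ => μ) :=
    (memLp_coord hL2 i).integrable (by norm_num)
  have h := ProbabilityTheory.variance_sum_pi hX
  rw [hsum, ProbabilityTheory.variance_of_integral_eq_zero hL.aemeasurable
    (by rw [integral_finsetSum _ fun i _ => hI i]; simp [hmean])] at h
  have hXvar (i : ι) : ProbabilityTheory.variance (X i) μ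
      = if i ∈ A then ∫ y, y ^ 2 ∂μ else 0 := by
    by_cases hi : i ∈ A
    · simp only [X, hi, if_true]
      exact hvar
    · simp only [X, hi, if_false]
      exact ProbabilityTheory.variance_zero μ
  simp only [hXvar, Finset.sum_ite_mem, Finset.univ_inter, Finset.sum_const, nsmul_eq_mul] at h
  simp only [avg, div_pow, integral_div]
  rw [h]
  rcases A.eq_empty_or_nonempty with rfl | hA
  · simp
  · have : (A.card : ℝ) ≠ 0 := by simpa using hA.ne_empty
    field_simp

/-- The means over a decreasing chain of index sets form a martingale; this is Doob's `L²`
maximal inequality for it. -/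
lemma integral_sq_runMax_avg_le (hL2 : MemLp id 2 μ) (h0 : ∫ y, y ∂μ = 0) (c : ℝ)
    {A : ℕ → Finset ι} (hA : Antitone A) {T : ℕ} (hT : (A T).Nonempty) :
    ∫ x, runMax (fun t => c * avg (A t) x) T ^ 2 ∂(Measure.pi fun _ : ι => μ)
      ≤ 4 * c ^ 2 * (∫ y, y ^ 2 ∂μ) / (A T).card := by
  have hz (t : ℕ) := (memLp_avg hL2 (A t)).const_mul c
  have hI1 := ((hz T).integrable_sq).const_mul 4
  have hI2 (t : ℕ) : Integrable (fun x : ι → ℝ => runMax (fun t => c * avg (A t) x) t *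
      (c * avg (A (t + 1)) x - c * avg (A t) x)) (Measure.pi fun _ => μ) :=
    (memLp_runMax_avg hL2 c A t).integrable_mul ((hz (t + 1)).sub (hz t))
  have hI3 := (integrable_finsetSum (Finset.range T) fun t _ => hI2 t).const_mul 4
  calc ∫ x, runMax (fun t => c * avg (A t) x) T ^ 2 ∂(Measure.pi fun _ : ι => μ)
      ≤ ∫ x, (4 * (c * avg (A T) x) ^ 2 - 4 * ∑ t ∈ Finset.range T,
          runMax (fun t => c * avg (A t) x) t * (c * avg (A (t + 1)) x - c * avg (A t) x))
          ∂(Measure.pi fun _ : ι => μ) :=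
        integral_mono (memLp_runMax_avg hL2 c A T).integrable_sq (hI1.sub hI3)
          fun x => sq_runMax_le _ _
    _ = 4 * c ^ 2 * (∫ y, y ^ 2 ∂μ) / (A T).card := by
        rw [integral_sub hI1 hI3, integral_const_mul, integral_const_mul,
          integral_finsetSum _ fun t _ => hI2 t, Finset.sum_eq_zero fun t ht => ?_]
        · simp only [mul_pow, integral_const_mul, integral_sq_avg hL2 h0]
          ring
        · exact integral_runMax_mul_eq_zero hL2 c hA
            (hT.mono (hA (by simpa using ht)))

end maximal

/-! ### Moments of the Laplace distribution -/

lemma integrable_and_integral_laplace {b : ℝ} (hb : 0 < b) (m : ℕ) :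
    Integrable (fun x : ℝ => |x| ^ m * Real.exp (-|x| / b)) ∧
      ∫ x : ℝ, |x| ^ m * Real.exp (-|x| / b) = 2 * (b ^ (m + 1) * m.factorial) := by
  have h : ∫ x : ℝ, |x| ^ m * Real.exp (-|x| / b) = 2 * (b ^ (m + 1) * m.factorial) := by
    rw [integral_comp_abs (f := fun x => x ^ m * Real.exp (-x / b))]
    congr 1
    have := Real.integral_rpow_mul_exp_neg_mul_Ioi (a := m + 1) (r := 1 / b)
      (by positivity) (by positivity)
    rw [Real.Gamma_nat_eq_factorial] at this
    simp only [add_sub_cancel_right, Real.rpow_natCast, one_div_one_div] at this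
    rw [← Nat.cast_succ, Real.rpow_natCast] at this
    rw [← this]
    refine integral_congr_ae (Filter.Eventually.of_forall fun x => ?_)
    simp only
    congr 2
    ring
  refine ⟨?_, h⟩
  by_contra hni
  rw [integral_undef hni] at h
  have : 0 < 2 * (b ^ (m + 1) * m.factorial) := by positivity
  linarith

lemma measurable_laplaceDensity (b : ℝ) :
    Measurable fun x : ℝ => ENNReal.ofReal ((2 * b)⁻¹ * Real.exp (-|x| / b)) := by
  fun_prop

lemma isProbabilityMeasure_laplaceMeasure {b : ℝ} (hb : 0 < b) :
    IsProbabilityMeasure (laplaceMeasure b) := by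
  obtain ⟨hi, h⟩ := integrable_and_integral_laplace hb 0
  simp only [pow_zero, one_mul] at hi h
  constructor
  rw [laplaceMeasure, withDensity_apply _ MeasurableSet.univ, Measure.restrict_univ,
    ← ofReal_integral_eq_lintegral_ofReal (hi.const_mul _)
      (Filter.Eventually.of_forall fun x => by positivity),
    integral_const_mul, h]
  simp only [Nat.factorial_zero]
  rw [← ENNReal.ofReal_one]
  congr 1
  push_cast
  field_simp

lemma integral_laplaceMeasure {b : ℝ} (hb : 0 < b) (g : ℝ → ℝ) :
    ∫ x, g x ∂(laplaceMeasure b) = ∫ x, (2 * b)⁻¹ * Real.exp (-|x| / b) * g x := by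
  rw [laplaceMeasure, integral_withDensity_eq_integral_toReal_smul (measurable_laplaceDensity b)
    (by simp)]
  refine integral_congr_ae (Filter.Eventually.of_forall fun x => ?_)
  simp only [smul_eq_mul]
  rw [ENNReal.toReal_ofReal (by positivity)]

lemma integral_sq_laplaceMeasure {b : ℝ} (hb : 0 < b) :
    ∫ x, x ^ 2 ∂(laplaceMeasure b) = 2 * b ^ 2 := by
  rw [integral_laplaceMeasure hb]
  have h := (integrable_and_integral_laplace hb 2).2
  simp only [sq_abs] at h
  have e (x : ℝ) : (2 * b)⁻¹ * Real.exp (-|x| / b) * x ^ 2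
      = (2 * b)⁻¹ * (x ^ 2 * Real.exp (-|x| / b)) := by ring
  simp only [e, integral_const_mul, h, Nat.factorial_two]
  push_cast
  field_simp

lemma integral_id_laplaceMeasure {b : ℝ} (hb : 0 < b) : ∫ x, x ∂(laplaceMeasure b) = 0 := by
  rw [integral_laplaceMeasure hb]
  have h := integral_neg_eq_self (fun x : ℝ => (2 * b)⁻¹ * Real.exp (-|x| / b) * x) volume
  simp only [abs_neg, mul_neg, integral_neg] at h
  linarith

lemma memLp_id_laplaceMeasure {b : ℝ} (hb : 0 < b) : MemLp id 2 (laplaceMeasure b) := by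
  refine (memLp_two_iff_integrable_sq measurable_id.aestronglyMeasurable).2 ?_
  by_contra h
  have h2 := integral_sq_laplaceMeasure hb
  have h3 := integral_undef h
  simp only [id_eq] at h3
  rw [h2] at h3
  have : 0 < 2 * b ^ 2 := by positivity
  linarith

/-! ### Harmonic sums over ranks -/

lemma sum_inv_card_filter_le {α : Type*} [LinearOrder α] (B : Finset α) :
    ∑ k ∈ B, (((B.filter fun i => k ≤ i).card : ℝ))⁻¹ = (harmonic B.card : ℝ) := by
  induction B using Finset.induction_on_min with
  | empty => simp
  | insert a B hB ih =>
    have ha : a ∉ B := fun h => lt_irrefl a (hB a h)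
    rw [Finset.sum_insert ha, Finset.card_insert_of_notMem ha, harmonic_succ,
      Finset.filter_true_of_mem, Finset.card_insert_of_notMem ha]
    · push_cast
      rw [← ih, add_comm]
      congr 1
      refine Finset.sum_congr rfl fun k hk => ?_
      rw [Finset.filter_insert, if_neg (not_le.2 (hB k hk))]
    · intro i hi
      rcases Finset.mem_insert.1 hi with rfl | hi
      · exact le_rfl
      · exact (hB i hi).le

lemma sum_inv_card_filter_ge {α : Type*} [LinearOrder α] (B : Finset α) :
    ∑ k ∈ B, (((B.filter fun i => i ≤ k).card : ℝ))⁻¹ = (harmonic B.card : ℝ) :=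
  sum_inv_card_filter_le (α := αᵒᵈ) B

lemma harmonic_le_log_pow_three (m : ℕ) :
    (harmonic m : ℝ) ≤ Real.log m ^ 3 + 2 := by
  have h1 := harmonic_le_one_add_log m
  have h2 := Real.log_natCast_nonneg m
  rcases le_total (Real.log m) 1 with h | h
  · have := pow_nonneg h2 3
    linarith
  · nlinarith [mul_nonneg h2 (sub_nonneg.2 h), mul_nonneg (mul_nonneg h2 h2) (sub_nonneg.2 h)]

/-! ### The error of the isotonic regression -/

/-- The indices between `t` and `b`. -/
def leftChain {n : ℕ} (b : Fin n) (t : ℕ) : Finset (Fin n) :=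
  Finset.univ.filter fun i => t ≤ (i : ℕ) ∧ i ≤ b

/-- The indices that are at least `a`, without the last `t` ones. -/
def rightChain {n : ℕ} (a : Fin n) (t : ℕ) : Finset (Fin n) :=
  Finset.univ.filter fun i => a ≤ i ∧ (i : ℕ) + t < n

lemma antitone_leftChain {n : ℕ} (b : Fin n) : Antitone (leftChain b) := by
  intro t u h i hi
  simp only [leftChain, Finset.mem_filter, Finset.mem_univ, true_and] at hi ⊢
  exact ⟨h.trans hi.1, hi.2⟩

lemma antitone_rightChain {n : ℕ} (a : Fin n) : Antitone (rightChain a) := by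
  intro t u h i hi
  simp only [rightChain, Finset.mem_filter, Finset.mem_univ, true_and] at hi ⊢
  exact ⟨hi.1, by omega⟩

lemma leftChain_eq_Icc {n : ℕ} (i b : Fin n) : leftChain b i = Finset.Icc i b := by
  ext m
  simp only [leftChain, Finset.mem_filter, Finset.mem_univ, true_and, Finset.mem_Icc, Fin.le_def]

lemma rightChain_eq_Icc {n : ℕ} (a j : Fin n) :
    rightChain a (n - 1 - j) = Finset.Icc a j := by
  ext m
  simp only [rightChain, Finset.mem_filter, Finset.mem_univ, true_and, Finset.mem_Icc, Fin.le_def]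
  omega

lemma avg_add {ι : Type*} (A : Finset ι) (x y : ι → ℝ) :
    avg A (fun i => x i + y i) = avg A x + avg A y := by
  simp only [avg, Finset.sum_add_distrib, add_div]

lemma avg_le {ι : Type*} {A : Finset ι} (hA : A.Nonempty) {x : ι → ℝ} {v : ℝ}
    (h : ∀ i ∈ A, x i ≤ v) : avg A x ≤ v := by
  rw [avg, div_le_iff₀ (by simpa using hA.card_pos), mul_comm, ← nsmul_eq_mul]
  exact Finset.sum_le_card_nsmul _ _ _ h

lemma le_avg {ι : Type*} {A : Finset ι} (hA : A.Nonempty) {x : ι → ℝ} {v : ℝ}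
    (h : ∀ i ∈ A, v ≤ x i) : v ≤ avg A x := by
  rw [avg, le_div_iff₀ (by simpa using hA.card_pos), mul_comm, ← nsmul_eq_mul]
  exact Finset.card_nsmul_le_sum _ _ _ h

lemma sq_iso_sub_le {n : ℕ} {s : Fin n → ℝ} (hs : Monotone s) (η : Fin n → ℝ) {a k b : Fin n}
    (hak : a ≤ k) (hkb : k ≤ b) (hsa : s a = s k) (hsb : s b = s k) :
    (iso (fun i => s i + η i) k - s k) ^ 2
      ≤ runMax (fun t => 1 * avg (leftChain b t) η) k ^ 2
        + runMax (fun t => (-1) * avg (rightChain a t) η) (n - 1 - k) ^ 2 := by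
  set U := runMax (fun t => 1 * avg (leftChain b t) η) k with hU
  set D := runMax (fun t => (-1) * avg (rightChain a t) η) (n - 1 - k) with hD
  have hU0 : 0 ≤ U := runMax_nonneg _ _
  have hD0 : 0 ≤ D := runMax_nonneg _ _
  have upper : iso (fun i => s i + η i) k - s k ≤ U := by
    obtain ⟨i, hik, h⟩ := exists_iso_le_seqMean (fun i => s i + η i) hkb
    rw [seqMean_eq_avg _ (hik.trans hkb), avg_add] at h
    have h1 : avg (Finset.Icc i b) s ≤ s k :=
      avg_le (by simpa using hik.trans hkb) fun m hm => hsb ▸ hs (Finset.mem_Icc.1 hm).2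
    have h2 := le_runMax (fun t => 1 * avg (leftChain b t) η) (Fin.le_def.1 hik)
    rw [leftChain_eq_Icc, one_mul] at h2
    linarith
  have lower : -D ≤ iso (fun i => s i + η i) k - s k := by
    obtain ⟨j, hkj, h⟩ := exists_seqMean_le_iso (fun i => s i + η i) hak
    rw [seqMean_eq_avg _ (hak.trans hkj), avg_add] at h
    have h1 : s k ≤ avg (Finset.Icc a j) s :=
      le_avg (by simpa using hak.trans hkj) fun m hm => hsa ▸ hs (Finset.mem_Icc.1 hm).1
    have h2 := le_runMax (fun t => (-1) * avg (rightChain a t) η)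
      (show n - 1 - (j : ℕ) ≤ n - 1 - k from Nat.sub_le_sub_left hkj _)
    rw [rightChain_eq_Icc] at h2
    linarith
  rcases le_total 0 (iso (fun i => s i + η i) k - s k) with h | h <;> nlinarith

/-- The error of the isotonic regression under centred i.i.d. noise with marginal `μ`. -/
lemma integral_sq_iso_sub_le {n : ℕ} {μ : Measure ℝ} [IsProbabilityMeasure μ]
    (hL2 : MemLp id 2 μ) (h0 : ∫ y, y ∂μ = 0) {s : Fin n → ℝ} (hs : Monotone s) :
    ∫ η, ∑ k, (iso (fun i => s i + η i) k - s k) ^ 2 ∂(Measure.pi fun _ : Fin n => μ)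
      ≤ ∑ v ∈ Finset.univ.image s, 8 * (∫ y, y ^ 2 ∂μ) *
          (harmonic (Finset.univ.filter fun k => s k = v).card : ℝ) := by
  classical
  set B : ℝ → Finset (Fin n) := fun v => Finset.univ.filter fun k => s k = v with hB
  have hmem (k : Fin n) : k ∈ B (s k) := by simp [hB]
  let a : Fin n → Fin n := fun k => (B (s k)).min' ⟨k, hmem k⟩
  let b : Fin n → Fin n := fun k => (B (s k)).max' ⟨k, hmem k⟩
  have hak (k : Fin n) : a k ≤ k := Finset.min'_le _ _ (hmem k)
  have hkb (k : Fin n) : k ≤ b k := Finset.le_max' _ _ (hmem k)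
  have hsa (k : Fin n) : s (a k) = s k :=
    (Finset.mem_filter.1 (Finset.min'_mem (B (s k)) ⟨k, hmem k⟩)).2
  have hsb (k : Fin n) : s (b k) = s k :=
    (Finset.mem_filter.1 (Finset.max'_mem (B (s k)) ⟨k, hmem k⟩)).2
  set V := ∫ y, y ^ 2 ∂μ with hV
  have hV0 : 0 ≤ V := integral_nonneg fun y => sq_nonneg y
  have hIU (k : Fin n) := (memLp_runMax_avg hL2 1 (leftChain (b k)) k).integrable_sq
  have hID (k : Fin n) :=
    (memLp_runMax_avg hL2 (-1) (rightChain (a k)) (n - 1 - k)).integrable_sq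
  have hIUD (k : Fin n) : Integrable
      (fun η => runMax (fun t => 1 * avg (leftChain (b k) t) η) k ^ 2
        + runMax (fun t => (-1) * avg (rightChain (a k) t) η) (n - 1 - k) ^ 2)
      (Measure.pi fun _ : Fin n => μ) := (hIU k).add (hID k)
  have hEU (k : Fin n) :
      ∫ η, runMax (fun t => 1 * avg (leftChain (b k) t) η) k ^ 2 ∂(Measure.pi fun _ : Fin n => μ)
        ≤ 4 * V * (((B (s k)).filter fun i => k ≤ i).card : ℝ)⁻¹ := by
    have hpos : 0 < ((B (s k)).filter fun i => k ≤ i).card :=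
      Finset.card_pos.2 ⟨k, by simp [hmem]⟩
    have hsub : (B (s k)).filter (fun i => k ≤ i) ⊆ leftChain (b k) k := by
      intro i hi
      rw [leftChain_eq_Icc, Finset.mem_Icc]
      exact ⟨(Finset.mem_filter.1 hi).2, Finset.le_max' _ _ (Finset.mem_filter.1 hi).1⟩
    have h := integral_sq_runMax_avg_le hL2 h0 1 (antitone_leftChain (b k)) (T := k)
      ((Finset.card_pos.1 hpos).mono hsub)
    refine h.trans ?_
    rw [one_pow, mul_one, div_eq_mul_inv]
    have := Finset.card_le_card hsub
    gcongr
  have hED (k : Fin n) :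
      ∫ η, runMax (fun t => (-1) * avg (rightChain (a k) t) η) (n - 1 - k) ^ 2
          ∂(Measure.pi fun _ : Fin n => μ)
        ≤ 4 * V * (((B (s k)).filter fun i => i ≤ k).card : ℝ)⁻¹ := by
    have hpos : 0 < ((B (s k)).filter fun i => i ≤ k).card :=
      Finset.card_pos.2 ⟨k, by simp [hmem]⟩
    have hsub : (B (s k)).filter (fun i => i ≤ k) ⊆ rightChain (a k) (n - 1 - k) := by
      intro i hi
      rw [rightChain_eq_Icc, Finset.mem_Icc]
      exact ⟨Finset.min'_le _ _ (Finset.mem_filter.1 hi).1, (Finset.mem_filter.1 hi).2⟩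
    have h := integral_sq_runMax_avg_le hL2 h0 (-1) (antitone_rightChain (a k))
      (T := n - 1 - k) ((Finset.card_pos.1 hpos).mono hsub)
    refine h.trans ?_
    rw [neg_one_sq, mul_one, div_eq_mul_inv]
    have := Finset.card_le_card hsub
    gcongr
  calc ∫ η, ∑ k, (iso (fun i => s i + η i) k - s k) ^ 2 ∂(Measure.pi fun _ : Fin n => μ)
      ≤ ∫ η, ∑ k, (runMax (fun t => 1 * avg (leftChain (b k) t) η) k ^ 2
          + runMax (fun t => (-1) * avg (rightChain (a k) t) η) (n - 1 - k) ^ 2)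
          ∂(Measure.pi fun _ : Fin n => μ) := by
        refine integral_mono_of_nonneg
          (Filter.Eventually.of_forall fun η => Finset.sum_nonneg fun k _ => sq_nonneg _)
          (integrable_finsetSum _ fun k _ => hIUD k)
          (Filter.Eventually.of_forall fun η => Finset.sum_le_sum fun k _ =>
            sq_iso_sub_le hs η (hak k) (hkb k) (hsa k) (hsb k))
    _ ≤ ∑ k, (4 * V * (((B (s k)).filter fun i => k ≤ i).card : ℝ)⁻¹
          + 4 * V * (((B (s k)).filter fun i => i ≤ k).card : ℝ)⁻¹) := by
        rw [integral_finsetSum _ fun k _ => hIUD k]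
        refine Finset.sum_le_sum fun k _ => ?_
        rw [integral_add (hIU k) (hID k)]
        exact add_le_add (hEU k) (hED k)
    _ = ∑ v ∈ Finset.univ.image s, 8 * V * (harmonic (B v).card : ℝ) := by
        rw [← Finset.sum_fiberwise_of_maps_to (s := Finset.univ) (t := Finset.univ.image s)
          (g := s) fun k hk => Finset.mem_image_of_mem s hk]
        refine Finset.sum_congr rfl fun v _ => ?_
        have e : ∑ k ∈ B v, (4 * V * (((B (s k)).filter fun i => k ≤ i).card : ℝ)⁻¹
              + 4 * V * (((B (s k)).filter fun i => i ≤ k).card : ℝ)⁻¹)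
            = ∑ k ∈ B v, (4 * V * (((B v).filter fun i => k ≤ i).card : ℝ)⁻¹
              + 4 * V * (((B v).filter fun i => i ≤ k).card : ℝ)⁻¹) := by
          refine Finset.sum_congr rfl fun k hk => ?_
          rw [(Finset.mem_filter.1 hk).2]
        rw [e, Finset.sum_add_distrib, ← Finset.mul_sum, ← Finset.mul_sum,
          sum_inv_card_filter_le, sum_inv_card_filter_ge]
        ring

/-- **Accuracy of constrained inference for unattributed histograms.**
There are universal constants `c₁, c₂` (independent of `n` and `d`) such that for any
nondecreasing `s ∈ ℝ^n` and any `ε > 0`, if `s̃ = s + η` with `η` i.i.d. `Laplace(1/ε)`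
noise and `s̄` is the isotonic regression of `s̃`, then
`E‖s̄ − s‖₂² ≤ Σ_{r=1}^{d} (c₁·log³ n_r + c₂)/ε²`, where the sum ranges over the `d`
distinct values of `s` and `n_r` is the number of occurrences of the `r`-th distinct
value; whereas `E‖s̃ − s‖₂² = 2n/ε²`. -/
theorem isotonic_regression_error_bound :
    ∃ c₁ c₂ : ℝ, ∀ (n : ℕ), 1 ≤ n → ∀ (ε : ℝ), 0 < ε → ∀ (s : Fin n → ℝ),
      Monotone s →
      ((∫ η, ∑ k, (iso (fun i => s i + η i) k - s k) ^ 2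
          ∂(Measure.pi fun _ : Fin n => laplaceMeasure (1 / ε)))
        ≤ ∑ v ∈ Finset.univ.image s,
            (c₁ * (Real.log ((Finset.univ.filter fun k => s k = v).card)) ^ 3 + c₂) / ε ^ 2)
      ∧ (∫ η, ∑ k, (η k) ^ 2 ∂(Measure.pi fun _ : Fin n => laplaceMeasure (1 / ε)))
          = 2 * n / ε ^ 2 := by
  refine ⟨16, 32, fun n _ ε hε s hs => ?_⟩
  have hb : 0 < 1 / ε := by positivity
  have := isProbabilityMeasure_laplaceMeasure hb
  have hL2 := memLp_id_laplaceMeasure hb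
  have hV := integral_sq_laplaceMeasure hb
  constructor
  · refine (integral_sq_iso_sub_le hL2 (integral_id_laplaceMeasure hb) hs).trans ?_
    refine Finset.sum_le_sum fun v _ => ?_
    have h := harmonic_le_log_pow_three (Finset.univ.filter fun k => s k = v).card
    rw [hV]
    calc 8 * (2 * (1 / ε) ^ 2) * (harmonic (Finset.univ.filter fun k => s k = v).card : ℝ)
        ≤ 8 * (2 * (1 / ε) ^ 2) *
            (Real.log (Finset.univ.filter fun k => s k = v).card ^ 3 + 2) := by gcongr
      _ = _ := by
        field_simp
        ring
  · rw [integral_finsetSum _ fun k _ => (memLp_coord hL2 k).integrable_sq]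
    have e (k : Fin n) :
        ∫ η : Fin n → ℝ, η k ^ 2 ∂(Measure.pi fun _ => laplaceMeasure (1 / ε))
          = 2 * (1 / ε) ^ 2 := by
      rw [← hV]
      exact integral_comp_eval (μ := fun _ : Fin n => laplaceMeasure (1 / ε))
        (f := fun y : ℝ => y ^ 2) (measurable_id.pow_const 2).aestronglyMeasurable
    simp only [e, Finset.sum_const, Finset.card_univ, Fintype.card_fin, nsmul_eq_mul]
    field_simp
end

section
/- Let α > 0, ℓ ≥ 1, 0 < δ' < 1, and let Y = Σ_{i=1}^{c} γ_i be a sum of c ≤ 2ℓ independent random variables, each distributed as Laplace with scale ℓ/α. Then Pr[ |Y| ≤ 16·ℓ^{3/2}·ln(2/δ')/α ] ≥ 1 − δ'. (This bounds the absolute error of answering a single range query via the hierarchical mechanism H̃, which sums at most 2ℓ noisy subtree counts, each carrying Laplace(ℓ/α) noise.) -/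
open MeasureTheory

/-- The moment generating function of the Laplace measure, as a Lebesgue integral. -/
lemma lintegral_exp_mul_laplaceMeasure {b t : ℝ} (hb : 0 < b) (ht : |t| * b < 1) :
    ∫⁻ x, ENNReal.ofReal (Real.exp (t * x)) ∂laplaceMeasure b
      = ENNReal.ofReal (1 - (t * b) ^ 2)⁻¹ := by
  have hu : t * b < 1 := (mul_le_mul_of_nonneg_right (le_abs_self t) hb.le).trans_lt ht
  have hl : -(t * b) < 1 := by
    rw [← neg_mul]
    exact (mul_le_mul_of_nonneg_right (neg_le_abs t) hb.le).trans_lt ht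
  have hpos : 0 < t + 1 / b := by
    have : t + 1 / b = (1 + t * b) / b := by field_simp; ring
    rw [this]; exact div_pos (by linarith) hb
  have hneg : t - 1 / b < 0 := by
    have : t - 1 / b = (t * b - 1) / b := by field_simp
    rw [this]; exact div_neg_of_neg_of_pos (by linarith) hb
  set f : ℝ → ℝ := fun x => (2 * b)⁻¹ * Real.exp (-|x| / b) * Real.exp (t * x) with hf
  have hfl : Set.EqOn f (fun x => (2 * b)⁻¹ * Real.exp ((t + 1 / b) * x)) (Set.Iic 0) := by
    intro x hx
    simp only [hf, mul_assoc, ← Real.exp_add, abs_of_nonpos (Set.mem_Iic.1 hx)]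
    congr 2; ring
  have hfr : Set.EqOn f (fun x => (2 * b)⁻¹ * Real.exp ((t - 1 / b) * x)) (Set.Ioi 0) := by
    intro x hx
    simp only [hf, mul_assoc, ← Real.exp_add, abs_of_pos (Set.mem_Ioi.1 hx)]
    congr 2; ring
  have hil : IntegrableOn f (Set.Iic 0) :=
    (integrableOn_congr_fun hfl measurableSet_Iic).2
      ((integrableOn_exp_mul_Iic hpos 0).const_mul _)
  have hir : IntegrableOn f (Set.Ioi 0) :=
    (integrableOn_congr_fun hfr measurableSet_Ioi).2
      ((integrableOn_exp_mul_Ioi hneg 0).const_mul _)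
  have hint : Integrable f := by
    rw [← integrableOn_univ, ← Set.Iic_union_Ioi (a := (0 : ℝ))]
    exact hil.union hir
  have hval : ∫ x, f x = (1 - (t * b) ^ 2)⁻¹ := by
    rw [← intervalIntegral.integral_Iic_add_Ioi hil hir,
      setIntegral_congr_fun measurableSet_Iic hfl, setIntegral_congr_fun measurableSet_Ioi hfr,
      integral_const_mul, integral_const_mul, integral_exp_mul_Iic hpos,
      integral_exp_mul_Ioi hneg]
    have h1 : 1 + t * b ≠ 0 := by linarith
    have h2 : t * b - 1 ≠ 0 := by linarith
    have e1 : t + 1 / b = (1 + t * b) / b := by field_simp; ring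
    have e2 : t - 1 / b = (t * b - 1) / b := by field_simp
    rw [e1, e2]
    simp only [mul_zero, Real.exp_zero]
    refine eq_inv_of_mul_eq_one_left ?_
    generalize t * b = u at h1 h2 ⊢
    field_simp
    ring
  rw [laplaceMeasure, lintegral_withDensity_eq_lintegral_mul _ (by fun_prop) (by fun_prop), ← hval,
    ofReal_integral_eq_lintegral_ofReal hint
      (.of_forall fun x => by simp only [hf, Pi.zero_apply]; positivity)]
  refine lintegral_congr fun x => ?_
  rw [Pi.mul_apply, ← ENNReal.ofReal_mul (by positivity)]

lemma integrable_exp_mul_laplaceMeasure {b t : ℝ} (hb : 0 < b) (ht : |t| * b < 1) :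
    Integrable (fun x => Real.exp (t * x)) (laplaceMeasure b) := by
  rw [← lintegral_ofReal_ne_top_iff_integrable (by fun_prop) (.of_forall fun x => by positivity),
    lintegral_exp_mul_laplaceMeasure hb ht]
  exact ENNReal.ofReal_ne_top

lemma integral_exp_mul_laplaceMeasure {b t : ℝ} (hb : 0 < b) (ht : |t| * b < 1) :
    ∫ x, Real.exp (t * x) ∂laplaceMeasure b = (1 - (t * b) ^ 2)⁻¹ := by
  rw [integral_eq_lintegral_of_nonneg_ae (.of_forall fun x => by positivity) (by fun_prop),
    lintegral_exp_mul_laplaceMeasure hb ht, ENNReal.toReal_ofReal]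
  have : |t * b| < 1 := by rwa [abs_mul, abs_of_pos hb]
  exact inv_nonneg.2 (sub_nonneg.2 ((sq_le_one_iff_abs_le_one _).2 this.le))

open ProbabilityTheory in
/-- Chernoff bound for both tails of a sum of independent Laplace variables. -/
lemma measureReal_lt_abs_sum_laplaceMeasure_le {b t : ℝ} (hb : 0 < b) (ht0 : 0 ≤ t)
    (ht : t * b < 1) (c : ℕ) (T : ℝ) :
    (Measure.pi fun _ : Fin c => laplaceMeasure b).real {ω | T < |∑ i, ω i|}
      ≤ 2 * (Real.exp (-t * T) * ((1 - (t * b) ^ 2)⁻¹) ^ c) := by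
  have := isProbabilityMeasure_laplaceMeasure hb
  set μ := Measure.pi fun _ : Fin c => laplaceMeasure b
  have key : ∀ s : ℝ, |s| = t →
      Integrable (fun ω : Fin c → ℝ => Real.exp (s * ∑ i, ω i)) μ ∧
      mgf (fun ω : Fin c → ℝ => ∑ i, ω i) μ s = ((1 - (t * b) ^ 2)⁻¹) ^ c := by
    intro s hs
    have hsb : |s| * b < 1 := by rwa [hs]
    have hsq : (s * b) ^ 2 = (t * b) ^ 2 := by rw [← hs, mul_pow, mul_pow, sq_abs]
    simp only [mgf, Finset.mul_sum, Real.exp_sum]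
    refine ⟨Integrable.fintype_prod fun _ => integrable_exp_mul_laplaceMeasure hb hsb, ?_⟩
    rw [integral_fintype_prod_eq_prod (fun _ x => Real.exp (s * x))]
    simp [integral_exp_mul_laplaceMeasure hb hsb, hsq]
  obtain ⟨hi1, hm1⟩ := key t (abs_of_nonneg ht0)
  obtain ⟨hi2, hm2⟩ := key (-t) (by rw [abs_neg, abs_of_nonneg ht0])
  have h1 := measure_ge_le_exp_mul_mgf T ht0 hi1
  have h2 := measure_le_le_exp_mul_mgf (-T) (neg_nonpos.2 ht0) hi2
  rw [hm1] at h1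
  rw [hm2, neg_neg, mul_neg, ← neg_mul] at h2
  calc μ.real {ω | T < |∑ i, ω i|}
      ≤ μ.real ({ω | T ≤ ∑ i, ω i} ∪ {ω | ∑ i, ω i ≤ -T}) := by
        refine measureReal_mono fun ω hω => ?_
        rcases lt_abs.1 (Set.mem_ofPred.1 hω) with h | h
        · exact Or.inl h.le
        · exact Or.inr (by simp only [Set.mem_ofPred_eq]; linarith)
    _ ≤ _ := (measureReal_union_le _ _).trans (by linarith)

/-- **Concentration for a sum of at most `2ℓ` Laplace(ℓ/α) variables.**
If `Y = Σ_{i=1}^{c} γ_i` with the `γ_i` independent `Laplace(ℓ/α)` random variables and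
`c ≤ 2ℓ`, then `Pr[ |Y| ≤ 16·ℓ^{3/2}·ln(2/δ')/α ] ≥ 1 − δ'`. -/
theorem sum_laplace_concentration (α : ℝ) (hα : 0 < α) (ℓ : ℕ) (hℓ : 1 ≤ ℓ)
    (δ' : ℝ) (hδ0 : 0 < δ') (hδ1 : δ' < 1) (c : ℕ) (hc : c ≤ 2 * ℓ) :
    ENNReal.ofReal (1 - δ')
      ≤ (Measure.pi fun _ : Fin c => laplaceMeasure ((ℓ : ℝ) / α))
          {ω | |∑ i, ω i| ≤ 16 * (ℓ : ℝ) ^ ((3 : ℝ) / 2) * Real.log (2 / δ') / α} := by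
  have hℓ1 : (1 : ℝ) ≤ ℓ := by exact_mod_cast hℓ
  have hℓ0 : (0 : ℝ) < ℓ := by linarith
  have hb : 0 < (ℓ : ℝ) / α := by positivity
  have hs0 : 0 < √(ℓ : ℝ) := Real.sqrt_pos.2 hℓ0
  have hs1 : 1 ≤ √(ℓ : ℝ) := Real.one_le_sqrt.2 hℓ1
  have hss : √(ℓ : ℝ) ^ 2 = ℓ := Real.sq_sqrt hℓ0.le
  have hpow : (ℓ : ℝ) ^ ((3 : ℝ) / 2) = ℓ * √(ℓ : ℝ) := by
    rw [show (3 : ℝ) / 2 = 1 + 1 / 2 by norm_num, Real.rpow_add hℓ0, Real.rpow_one,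
      ← Real.sqrt_eq_rpow]
  have := isProbabilityMeasure_laplaceMeasure hb
  set μ := Measure.pi fun _ : Fin c => laplaceMeasure ((ℓ : ℝ) / α)
  set L := Real.log (2 / δ') with hL
  set T := 16 * (ℓ : ℝ) ^ ((3 : ℝ) / 2) * L / α with hT
  set t := α / (2 * (ℓ * √(ℓ : ℝ))) with ht
  have hexpL : Real.exp (-L) = δ' / 2 := by
    rw [hL, Real.exp_neg, Real.exp_log (by positivity), inv_div]
  have hL1 : 1 / 2 ≤ L := by
    have h2 : Real.log 2 ≤ L := Real.log_le_log (by norm_num) (by rw [le_div_iff₀ hδ0]; linarith)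
    linarith [Real.log_two_gt_d9]
  have htb : t * (ℓ / α) = 1 / (2 * √(ℓ : ℝ)) := by rw [ht]; field_simp
  have htT : -t * T = -(8 * L) := by rw [ht, hT, hpow]; field_simp; norm_num
  have hsq : (t * (ℓ / α)) ^ 2 = 1 / (4 * ℓ) := by
    rw [htb, div_pow, mul_pow, hss]; norm_num
  have htail := measureReal_lt_abs_sum_laplaceMeasure_le (t := t) hb (by positivity)
    (by rw [htb, div_lt_one (by positivity)]; linarith) c T
  have hfactor : (1 - 1 / (4 * (ℓ : ℝ)))⁻¹ ≤ Real.exp (1 / (2 * ℓ)) := by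
    have h4 : 1 / (4 * (ℓ : ℝ)) ≤ 1 / 4 := by
      apply one_div_le_one_div_of_le <;> linarith
    have h0 : 0 < 1 / (4 * (ℓ : ℝ)) := by positivity
    have he : 1 / (2 * (ℓ : ℝ)) = 2 * (1 / (4 * ℓ)) := by field_simp; norm_num
    rw [he]
    refine le_trans ?_ (Real.add_one_le_exp _)
    rw [inv_le_iff_one_le_mul₀ (by linarith)]
    nlinarith
  have hprod : ((1 - 1 / (4 * (ℓ : ℝ)))⁻¹) ^ c ≤ Real.exp 1 := by
    have h4 : 1 / (4 * (ℓ : ℝ)) ≤ 1 := by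
      rw [div_le_one (by positivity)]; linarith
    refine (pow_le_pow_left₀ (inv_nonneg.2 (by linarith)) hfactor c).trans ?_
    rw [← Real.exp_nat_mul, Real.exp_le_exp]
    have : (c : ℝ) ≤ 2 * ℓ := by exact_mod_cast hc
    rw [mul_one_div, div_le_one (by positivity)]
    exact this
  have hbad : μ.real {ω | T < |∑ i, ω i|} ≤ δ' := by
    refine htail.trans ?_
    rw [hsq, htT]
    calc 2 * (Real.exp (-(8 * L)) * ((1 - 1 / (4 * (ℓ : ℝ)))⁻¹) ^ c)
        ≤ 2 * (Real.exp (-(8 * L)) * Real.exp 1) := by gcongr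
      _ = 2 * Real.exp (-(8 * L) + 1) := by rw [Real.exp_add]
      _ ≤ 2 * Real.exp (-L) := by gcongr; linarith
      _ = δ' := by rw [hexpL]; ring
  have hmeas : MeasurableSet {ω : Fin c → ℝ | T < |∑ i, ω i|} :=
    measurableSet_lt (by fun_prop) (by fun_prop)
  have hcompl : {ω : Fin c → ℝ | |∑ i, ω i| ≤ T} = {ω | T < |∑ i, ω i|}ᶜ := by
    ext ω; simp
  rw [hcompl, ← ofReal_measureReal, probReal_compl_eq_one_sub hmeas]
  exact ENNReal.ofReal_le_ofReal (by linarith)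
end
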